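/- Let G be a connected graph on n vertices and let G' = G + e be the graph obtained by adding a new edge e ∉ E(G). Let γ_1^L(G) ≥ γ_2^L(G) ≥ ⋯ ≥ γ_n^L(G) = 0 and γ_1^L(G') ≥ γ_2^L(G') ≥ ⋯ ≥ γ_n^L(G') = 0 be the eigenvalues of R^L(G) and R^L(G') respectively, in decreasing order. Then γ_i^L(G) ≥ γ_i^L(G') for every i = 1, 2, …, n. -/

import Mathlib

open Matrix Polynomial BigOperators

/-- `Ldag` is the Moore–Penrose inverse of `L`: `L Ldag L = L`, `Ldag L Ldag = Ldag`,
and both `L Ldag` and `Ldag L` are symmetric. -/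
def IsMoorePenroseInv {V : Type*} [Fintype V] (L Ldag : Matrix V V ℝ) : Prop :=
  L * Ldag * L = L ∧ Ldag * L * Ldag = Ldag ∧
    (L * Ldag)ᵀ = L * Ldag ∧ (Ldag * L)ᵀ = Ldag * L

/-- The resistance distance between vertices `i` and `j`, computed from the
Moore–Penrose inverse `Ldag` of the Laplacian: `r(i,j) = Ldag i i + Ldag j j - 2 Ldag i j`. -/
def resDist {V : Type*} (Ldag : Matrix V V ℝ) (i j : V) : ℝ :=
  Ldag i i + Ldag j j - 2 * Ldag i j

/-- The resistance distance matrix `R(G)`. -/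
def resMatrix {V : Type*} [DecidableEq V] (Ldag : Matrix V V ℝ) : Matrix V V ℝ :=
  Matrix.of fun i j => if i = j then 0 else resDist Ldag i j

/-- The resistance transmission `RTr(v) = ∑ u, r(u,v)` of a vertex `v`. -/
def resTrans {V : Type*} [Fintype V] (Ldag : Matrix V V ℝ) (v : V) : ℝ :=
  ∑ u, resDist Ldag u v

/-- The resistance Laplacian matrix `R^L = Diag(RTr) - R`. -/
def resLap {V : Type*} [Fintype V] [DecidableEq V] (Ldag : Matrix V V ℝ) : Matrix V V ℝ :=
  Matrix.diagonal (resTrans Ldag) - resMatrix Ldag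

/-- The resistance signless Laplacian matrix `R^Q = Diag(RTr) + R`. -/
def resSignlessLap {V : Type*} [Fintype V] [DecidableEq V] (Ldag : Matrix V V ℝ) :
    Matrix V V ℝ :=
  Matrix.diagonal (resTrans Ldag) + resMatrix Ldag

instance {V W : Type*} : DecidableRel (completeBipartiteGraph V W).Adj := fun v w => by
  simp only [completeBipartiteGraph_adj]
  infer_instance

lemma mp_symm {V : Type*} [Fintype V] {A P : Matrix V V ℝ} (hA : Aᵀ = A)
    (h : IsMoorePenroseInv A P) : Pᵀ = P := by
  obtain ⟨h1, h2, h3, h4⟩ := h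
  have e3 : Pᵀ * A = A * P := by rw [← h3, transpose_mul, hA]
  have e4 : A * Pᵀ = P * A := by rw [← h4, transpose_mul, hA]
  have e1 : A * Pᵀ * A = A := by
    have := congrArg transpose h1
    simpa [transpose_mul, hA, Matrix.mul_assoc] using this
  have e2 : Pᵀ * A * Pᵀ = Pᵀ := by
    have := congrArg transpose h2
    simpa [transpose_mul, hA, Matrix.mul_assoc] using this
  have k : A * P = P * A := by
    have s1 : A * P = (P * A) * (A * P) := by
      calc A * P = (A * Pᵀ * A) * P := by rw [e1]
        _ = (A * Pᵀ) * (A * P) := by simp only [Matrix.mul_assoc]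
        _ = _ := by rw [e4]
    have s2 : P * A = (P * A) * (A * P) := by
      calc P * A = P * (A * Pᵀ * A) := by rw [e1]
        _ = (P * A) * (Pᵀ * A) := by simp only [Matrix.mul_assoc]
        _ = _ := by rw [e3]
    rw [s1, ← s2]
  calc Pᵀ = Pᵀ * A * Pᵀ := e2.symm
    _ = P * A * Pᵀ := by rw [e3, k]
    _ = P * (A * Pᵀ) := by rw [Matrix.mul_assoc]
    _ = P * A * P := by rw [Matrix.mul_assoc P A P, e4, k]
    _ = P := h2

lemma lap_mp_mulVec {n : ℕ} (G : SimpleGraph (Fin n)) [DecidableRel G.Adj]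
    (hG : G.Connected) {P : Matrix (Fin n) (Fin n) ℝ}
    (h : IsMoorePenroseInv (G.lapMatrix ℝ) P) (e : Fin n → ℝ) (he : ∑ i, e i = 0) :
    G.lapMatrix ℝ *ᵥ (P *ᵥ e) = e := by
  have hL : (G.lapMatrix ℝ)ᵀ = G.lapMatrix ℝ := G.isSymm_lapMatrix (R := ℝ)
  have hP := mp_symm hL h
  obtain ⟨h1, h2, h3, h4⟩ := h
  set L := G.lapMatrix ℝ with hLd
  have hLLP : L * (L * P) = L := by
    rw [← h3, transpose_mul, hL, hP, ← Matrix.mul_assoc, h1]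
  set z := L *ᵥ (P *ᵥ e) - e with hz
  have hLz : L *ᵥ z = 0 := by
    rw [hz, mulVec_sub, mulVec_mulVec, mulVec_mulVec, Matrix.mul_assoc, hLLP, sub_self]
  have hc := (G.lapMatrix_mulVec_eq_zero_iff_forall_reachable).1 hLz
  have hs : ∑ i, z i = 0 := by
    have h1' : (fun _ => (1:ℝ)) ⬝ᵥ (L *ᵥ (P *ᵥ e)) = 0 := by
      rw [dotProduct_mulVec, ← mulVec_transpose, hL, G.lapMatrix_mulVec_const_eq_zero]
      simp
    have : ∑ i, z i = (fun _ => (1:ℝ)) ⬝ᵥ (L *ᵥ (P *ᵥ e)) - ∑ i, e i := by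
      simp [hz, dotProduct, Finset.sum_sub_distrib]
    rw [this, h1', he, sub_zero]
  have hz0 : z = 0 := by
    funext i
    have : ∑ j, z j = n * z i := by
      rw [Finset.sum_congr rfl (fun j _ => hc j i (hG.preconnected j i))]
      simp
    rw [hs] at this
    have hn : (n:ℝ) ≠ 0 := by
      have := i.pos
      positivity
    simpa [hn] using this.symm
  exact sub_eq_zero.1 hz0

lemma lap_le {n : ℕ} (G G' : SimpleGraph (Fin n)) [DecidableRel G.Adj] [DecidableRel G'.Adj]
    (hle : G ≤ G') (x : Fin n → ℝ) :
    x ⬝ᵥ (G.lapMatrix ℝ *ᵥ x) ≤ x ⬝ᵥ (G'.lapMatrix ℝ *ᵥ x) := by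
  rw [← toLinearMap₂'_apply', ← toLinearMap₂'_apply', SimpleGraph.lapMatrix_toLinearMap₂',
    SimpleGraph.lapMatrix_toLinearMap₂']
  apply div_le_div_of_nonneg_right _ (by norm_num)
  refine Finset.sum_le_sum fun i _ => Finset.sum_le_sum fun j _ => ?_
  by_cases h : G.Adj i j
  · simp [h, hle h]
  · simp only [h, if_false]
    split_ifs <;> positivity

lemma resDist_eq {n : ℕ} {P : Matrix (Fin n) (Fin n) ℝ} (hP : Pᵀ = P) (i j : Fin n) :
    resDist P i j = (Pi.single i 1 - Pi.single j 1) ⬝ᵥ (P *ᵥ (Pi.single i 1 - Pi.single j 1)) := by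
  have : P j i = P i j := congrFun (congrFun hP i) j
  simp [resDist, mulVec_sub, sub_dotProduct, this]
  ring

lemma resDist_le {n : ℕ} (G G' : SimpleGraph (Fin n)) [DecidableRel G.Adj] [DecidableRel G'.Adj]
    (hle : G ≤ G') (hG : G.Connected) {P P' : Matrix (Fin n) (Fin n) ℝ}
    (h : IsMoorePenroseInv (G.lapMatrix ℝ) P) (h' : IsMoorePenroseInv (G'.lapMatrix ℝ) P')
    (i j : Fin n) : resDist P' i j ≤ resDist P i j := by
  have hL : (G.lapMatrix ℝ)ᵀ = G.lapMatrix ℝ := G.isSymm_lapMatrix (R := ℝ)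
  have hL' : (G'.lapMatrix ℝ)ᵀ = G'.lapMatrix ℝ := G'.isSymm_lapMatrix (R := ℝ)
  rw [resDist_eq (mp_symm hL h), resDist_eq (mp_symm hL' h')]
  set e : Fin n → ℝ := Pi.single i 1 - Pi.single j 1 with he
  have hs : ∑ k, e k = 0 := by simp [he, Finset.sum_sub_distrib]
  have h1 := lap_mp_mulVec G hG h e hs
  have h2 := lap_mp_mulVec G' (hG.mono hle) h' e hs
  set y := P *ᵥ e
  set y' := P' *ᵥ e
  have h3 := lap_le G G' hle y'
  rw [h2] at h3
  have h4 := (G.posSemidef_lapMatrix ℝ).dotProduct_mulVec_nonneg (y - y')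
  rw [star_trivial, mulVec_sub, h1, dotProduct_sub, sub_dotProduct, sub_dotProduct] at h4
  have h5 : y ⬝ᵥ (G.lapMatrix ℝ *ᵥ y') = y' ⬝ᵥ e := by
    rw [dotProduct_mulVec, ← mulVec_transpose, hL, h1, dotProduct_comm]
  rw [h5] at h4
  rw [dotProduct_comm e y, dotProduct_comm e y']
  linarith

lemma resLap_eq {n : ℕ} (P : Matrix (Fin n) (Fin n) ℝ) :
    resLap P = diagonal (resTrans P) - Matrix.of (resDist P) := by
  have : resMatrix P = Matrix.of (resDist P) := by
    ext i j
    simp only [resMatrix, of_apply]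
    split_ifs with h
    · subst h; simp [resDist]; ring
    · rfl
  rw [resLap, this]

lemma resDist_comm {n : ℕ} {P : Matrix (Fin n) (Fin n) ℝ} (hP : Pᵀ = P) (i j : Fin n) :
    resDist P i j = resDist P j i := by
  have : P j i = P i j := congrFun (congrFun hP i) j
  simp [resDist, this]; ring

lemma resLap_symm {n : ℕ} {P : Matrix (Fin n) (Fin n) ℝ} (hP : Pᵀ = P) :
    (resLap P).IsHermitian := by
  rw [resLap_eq]
  apply IsHermitian.sub
  · simp [IsHermitian]
  · ext i j
    simp [resDist_comm hP i j]

lemma resLap_quad {n : ℕ} {P : Matrix (Fin n) (Fin n) ℝ} (hP : Pᵀ = P) (x : Fin n → ℝ) :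
    x ⬝ᵥ (resLap P *ᵥ x) = (∑ i, ∑ j, resDist P i j * (x i - x j) ^ 2) / 2 := by
  have h1 : x ⬝ᵥ (resLap P *ᵥ x)
      = ∑ i, ∑ j, resDist P i j * x i ^ 2 - ∑ i, ∑ j, resDist P i j * (x i * x j) := by
    rw [resLap_eq, sub_mulVec, dotProduct_sub]
    congr 1
    · simp only [dotProduct, mulVec_diagonal, resTrans, Finset.sum_mul, Finset.mul_sum]
      refine Finset.sum_congr rfl fun i _ => Finset.sum_congr rfl fun j _ => ?_
      rw [resDist_comm hP j i]; ring
    · simp only [dotProduct, mulVec, of_apply, Finset.mul_sum]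
      refine Finset.sum_congr rfl fun i _ => Finset.sum_congr rfl fun j _ => ?_
      ring
  have h2 : ∑ i, ∑ j, resDist P i j * x j ^ 2 = ∑ i, ∑ j, resDist P i j * x i ^ 2 := by
    rw [Finset.sum_comm]
    refine Finset.sum_congr rfl fun i _ => Finset.sum_congr rfl fun j _ => ?_
    rw [resDist_comm hP j i]
  have h3 : ∑ i, ∑ j, resDist P i j * (x i - x j) ^ 2 =
      ∑ i, ∑ j, resDist P i j * x i ^ 2 + ∑ i, ∑ j, resDist P i j * x j ^ 2
       - 2 * ∑ i, ∑ j, resDist P i j * (x i * x j) := by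
    simp only [Finset.mul_sum, ← Finset.sum_add_distrib, ← Finset.sum_sub_distrib]
    refine Finset.sum_congr rfl fun i _ => Finset.sum_congr rfl fun j _ => ?_
    ring
  rw [h1, h3, h2]; ring

lemma exists_perm_eig {n : ℕ} (γ e : Fin n → ℝ) (hγ : Antitone γ)
    (h : Multiset.map γ Finset.univ.val = Multiset.map e Finset.univ.val) :
    ∃ σ : Equiv.Perm (Fin n), γ = e ∘ σ := by
  refine ⟨Tuple.sort (fun i => - e i), ?_⟩
  set σ := Tuple.sort (fun i => - e i) with hσ
  have hm : Antitone (e ∘ σ) := by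
    intro i j hij
    have := Tuple.monotone_sort (fun i => - e i) hij
    simpa using this
  have hp : Multiset.map γ Finset.univ.val = Multiset.map (e ∘ σ) Finset.univ.val := by
    rw [h, ← Multiset.map_map]
    congr 1
    exact (Multiset.map_univ_val_equiv σ).symm
  rw [Fin.univ_val_map, Fin.univ_val_map, Multiset.coe_eq_coe] at hp
  apply List.ofFn_injective
  exact hp.eq_of_sortedGE hγ.sortedGE_ofFn hm.sortedGE_ofFn

lemma exists_diag {n : ℕ} {A : Matrix (Fin n) (Fin n) ℝ} (hA : A.IsHermitian)
    (γ : Fin n → ℝ) (hγ : Antitone γ) (hchar : A.charpoly = ∏ i, (X - C (γ i))) :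
    ∃ U : Matrix (Fin n) (Fin n) ℝ, U * Uᵀ = 1 ∧ A = U * diagonal γ * Uᵀ := by
  have hr : Multiset.map γ Finset.univ.val = Multiset.map hA.eigenvalues Finset.univ.val := by
    have h1 := hA.roots_charpoly_eq_eigenvalues
    rw [hchar, Polynomial.roots_prod _ _ (by
      simp [Finset.prod_ne_zero_iff, Polynomial.X_sub_C_ne_zero])] at h1
    simpa using h1
  obtain ⟨σ, rfl⟩ := exists_perm_eig γ _ hγ hr
  set W : Matrix (Fin n) (Fin n) ℝ := (hA.eigenvectorUnitary).1 with hW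
  have hWW : W * Wᵀ = 1 := by
    have := Unitary.coe_mul_star_self hA.eigenvectorUnitary
    simpa [star_eq_conjTranspose] using this
  have hs : A = W * diagonal hA.eigenvalues * Wᵀ := by
    have := hA.spectral_theorem
    rw [Unitary.conjStarAlgAut_apply] at this
    simpa [star_eq_conjTranspose, Function.comp_def] using this
  refine ⟨W.submatrix id σ, ?_, ?_⟩
  · rw [transpose_submatrix, submatrix_mul_equiv, hWW]; simp
  · have : diagonal (hA.eigenvalues ∘ σ) = (diagonal hA.eigenvalues).submatrix σ σ := by
      rw [submatrix_diagonal _ _ σ.injective]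
    rw [this, transpose_submatrix, submatrix_mul_equiv, submatrix_mul_equiv]
    simpa using hs

lemma quad_diag {n : ℕ} (U : Matrix (Fin n) (Fin n) ℝ) (γ : Fin n → ℝ) (x : Fin n → ℝ) :
    x ⬝ᵥ ((U * diagonal γ * Uᵀ) *ᵥ x) = ∑ j, γ j * ((Uᵀ *ᵥ x) j) ^ 2 := by
  rw [← mulVec_mulVec, ← mulVec_mulVec, dotProduct_mulVec, ← mulVec_transpose]
  simp only [dotProduct, mulVec_diagonal]
  refine Finset.sum_congr rfl fun i _ => ?_
  ring

lemma norm_diag {n : ℕ} {U : Matrix (Fin n) (Fin n) ℝ} (hU : U * Uᵀ = 1) (x : Fin n → ℝ) :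
    x ⬝ᵥ x = ∑ j, ((Uᵀ *ᵥ x) j) ^ 2 := by
  have := quad_diag U (fun _ => 1) x
  simpa [hU] using this

lemma weyl_mono {n : ℕ} {A B : Matrix (Fin n) (Fin n) ℝ} (hA : A.IsHermitian)
    (hB : B.IsHermitian) (γ γ' : Fin n → ℝ) (hγ : Antitone γ) (hγ' : Antitone γ')
    (hchar : A.charpoly = ∏ i, (X - C (γ i))) (hchar' : B.charpoly = ∏ i, (X - C (γ' i)))
    (hle : ∀ x, x ⬝ᵥ (B *ᵥ x) ≤ x ⬝ᵥ (A *ᵥ x)) (i : Fin n) : γ' i ≤ γ i := by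
  obtain ⟨U, hU, rfl⟩ := exists_diag hA γ hγ hchar
  obtain ⟨W, hW, rfl⟩ := exists_diag hB γ' hγ' hchar'
  let M : Matrix {j : Fin n // j ≠ i} (Fin n) ℝ :=
    Matrix.of fun j k => if j.1 < i then Uᵀ j.1 k else Wᵀ j.1 k
  have hker : LinearMap.ker M.mulVecLin ≠ ⊥ := by
    apply LinearMap.ker_ne_bot_of_finrank_lt
    simp only [Module.finrank_fintype_fun_eq_card, Fintype.card_fin]
    have h := Fintype.card_subtype_lt (p := fun j : Fin n => j ≠ i) (x := i) (by simp)
    rwa [Fintype.card_fin] at h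
  obtain ⟨x, hx, hx0⟩ := (Submodule.ne_bot_iff _).1 hker
  have hMx : M *ᵥ x = 0 := by simpa using hx
  have hUx : ∀ j, j < i → (Uᵀ *ᵥ x) j = 0 := by
    intro j hj
    have := congrFun hMx ⟨j, hj.ne⟩
    simpa [M, mulVec, dotProduct, hj] using this
  have hWx : ∀ j, i < j → (Wᵀ *ᵥ x) j = 0 := by
    intro j hj
    have := congrFun hMx ⟨j, hj.ne'⟩
    simpa [M, mulVec, dotProduct, hj.not_gt] using this
  have h1 : x ⬝ᵥ ((U * diagonal γ * Uᵀ) *ᵥ x) ≤ γ i * (x ⬝ᵥ x) := by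
    rw [quad_diag, norm_diag hU, Finset.mul_sum]
    refine Finset.sum_le_sum fun j _ => ?_
    rcases lt_or_ge j i with h | h
    · simp [hUx j h]
    · exact mul_le_mul_of_nonneg_right (hγ h) (sq_nonneg _)
  have h2 : γ' i * (x ⬝ᵥ x) ≤ x ⬝ᵥ ((W * diagonal γ' * Wᵀ) *ᵥ x) := by
    rw [quad_diag, norm_diag hW, Finset.mul_sum]
    refine Finset.sum_le_sum fun j _ => ?_
    rcases lt_or_ge i j with h | h
    · simp [hWx j h]
    · exact mul_le_mul_of_nonneg_right (hγ' h) (sq_nonneg _)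
  have hpos : 0 < x ⬝ᵥ x := by
    have h0 : 0 ≤ x ⬝ᵥ x := by
      simp only [dotProduct]; exact Finset.sum_nonneg fun j _ => mul_self_nonneg _
    exact lt_of_le_of_ne h0 fun h => hx0 (dotProduct_self_eq_zero.1 h.symm)
  exact le_of_mul_le_mul_right (h2.trans ((hle x).trans h1)) hpos

theorem resLap_eigenvalues_addEdge {n : ℕ} (hn : 0 < n)
    (G G' : SimpleGraph (Fin n)) [DecidableRel G.Adj] [DecidableRel G'.Adj]
    (hG : G.Connected) (u v : Fin n) (huv : u ≠ v) (hne : ¬ G.Adj u v)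
    (hG' : G' = G ⊔ SimpleGraph.fromEdgeSet {s(u, v)})
    (Ldag Ldag' : Matrix (Fin n) (Fin n) ℝ)
    (hpen : IsMoorePenroseInv (G.lapMatrix ℝ) Ldag)
    (hpen' : IsMoorePenroseInv (G'.lapMatrix ℝ) Ldag')
    (γ γ' : Fin n → ℝ) (hγ : Antitone γ) (hγ' : Antitone γ')
    (hchar : (resLap Ldag).charpoly = ∏ i, (X - C (γ i)))
    (hchar' : (resLap Ldag').charpoly = ∏ i, (X - C (γ' i)))
    (hlast : γ ⟨n - 1, by omega⟩ = 0) (hlast' : γ' ⟨n - 1, by omega⟩ = 0) :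
    ∀ i : Fin n, γ' i ≤ γ i := by
  have hle : G ≤ G' := hG' ▸ le_sup_left
  have hP := mp_symm (G.isSymm_lapMatrix (R := ℝ)) hpen
  have hP' := mp_symm (G'.isSymm_lapMatrix (R := ℝ)) hpen'
  refine weyl_mono (resLap_symm hP) (resLap_symm hP') γ γ' hγ hγ' hchar hchar' fun x => ?_
  rw [resLap_quad hP, resLap_quad hP']
  apply div_le_div_of_nonneg_right _ (by norm_num)
  refine Finset.sum_le_sum fun i _ => Finset.sum_le_sum fun j _ => ?_
  exact mul_le_mul_of_nonneg_right (resDist_le G G' hle hG hpen hpen' i j) (sq_nonneg _)
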